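/- If all proposers and all attesters follow the equilibrium strategy profile, then for every slot n ≥ 1 the most recent canonical slot before n is n_- = n − 1, so t_n − t_{n_-} = Δ, and every proposer n ≥ 1 receives payoff exactly α + μ·Δ. In particular the equilibrium proposer payoff is the same strictly positive value for all proposers and does not depend on the coordination point Δ* ∈ [0, Δ] (economic fairness among participants). -/

import Mathlib

/-!
Slot-based proposal game: on the equilibrium path, for every slot `n ≥ 1` the
most recent canonical slot is `n_- = n - 1`, so `t_n − t_{n_-} = Δ`, and every
proposer receives payoff exactly `α + μ·Δ > 0`; in particular the equilibrium
proposer payoff is the same strictly positive value for all proposers and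
does not depend on the coordination point `Δ* ∈ [0, Δ]`.
-/

open MeasureTheory
open scoped Classical

noncomputable section

/-- Successful-attestation measure: Lebesgue measure of the set of attesters
`i ∈ [0,1]` voting for the block. -/
def attMeasure (ν : ℝ → Prop) : ℝ :=
  (volume {i : ℝ | i ∈ Set.Icc (0 : ℝ) 1 ∧ ν i}).toReal

/-- Canonicity indicator of slot `n`: the next proposer builds on block `n`
and block `n` gathers at least measure `γ` of attestations. -/
def chi (γ : ℝ) (φ : ℕ → Prop) (ν : ℕ → ℝ → Prop) (n : ℕ) : Prop :=
  φ (n + 1) ∧ γ ≤ attMeasure (ν n)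

/-- The most recent canonical slot `n_- = max {k ≤ n - 1 : χ_k = 1}`. -/
def lastCanonical (γ : ℝ) (φ : ℕ → Prop) (ν : ℕ → ℝ → Prop) (n : ℕ) : ℕ :=
  sSup {k : ℕ | chi γ φ ν k ∧ k ≤ n - 1}

/-- Proposer `n`'s payoff: `α + μ·(t_n − t_{n_-})⁺` if block `n` is canonical,
`0` otherwise. -/
def proposerPayoff (α μ γ : ℝ) (t : ℕ → ℝ) (φ : ℕ → Prop) (ν : ℕ → ℝ → Prop)
    (n : ℕ) : ℝ :=
  if chi γ φ ν n then α + μ * max (t n - t (lastCanonical γ φ ν n)) 0 else 0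

/-- Proposer `n` acted "on path": released at `n·Δ + Δ*` and followed the
φ-rule (build on block `n-1` iff `t_{n-1} ≤ (n-1)·Δ + Δ*`). -/
def onPath (Δ Δstar : ℝ) (t : ℕ → ℝ) (φ : ℕ → Prop) (n : ℕ) : Prop :=
  t n = (n : ℝ) * Δ + Δstar ∧
    (φ n ↔ t (n - 1) ≤ ((n - 1 : ℕ) : ℝ) * Δ + Δstar)

/-- Equilibrium release times: `t_n = n·Δ + Δ*`. -/
def tEq (Δ Δstar : ℝ) (n : ℕ) : ℝ := (n : ℝ) * Δ + Δstar

/-- Equilibrium build decisions: `φ_n = 1` iff `t_{n-1} ≤ (n-1)·Δ + Δ*`. -/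
def phiEq (Δ Δstar : ℝ) (n : ℕ) : Prop :=
  tEq Δ Δstar (n - 1) ≤ ((n - 1 : ℕ) : ℝ) * Δ + Δstar

/-- Equilibrium votes, as a reaction to the realized proposer actions:
every attester `(i, n)` votes `1` iff proposer `n` acted on path. -/
def nuEq (Δ Δstar : ℝ) (t : ℕ → ℝ) (φ : ℕ → Prop) (n : ℕ) (_ : ℝ) : Prop :=
  onPath Δ Δstar t φ n

theorem phiEq_holds (Δ Δstar : ℝ) (n : ℕ) : phiEq Δ Δstar n :=
  le_refl _

theorem onPath_tEq_phiEq (Δ Δstar : ℝ) (n : ℕ) :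
    onPath Δ Δstar (tEq Δ Δstar) (phiEq Δ Δstar) n :=
  ⟨rfl, Iff.rfl⟩

theorem attMeasure_eq_one {ν : ℝ → Prop} (h : ∀ i, ν i) : attMeasure ν = 1 := by
  simp only [attMeasure, h, and_true, Set.ofPred_mem_eq, Real.volume_Icc]
  norm_num

theorem chi_equilibrium {γ : ℝ} (hγ : γ ≤ 1) (Δ Δstar : ℝ) (n : ℕ) :
    chi γ (phiEq Δ Δstar) (nuEq Δ Δstar (tEq Δ Δstar) (phiEq Δ Δstar)) n :=
  ⟨phiEq_holds Δ Δstar (n + 1),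
    hγ.trans_eq (attMeasure_eq_one fun _ => onPath_tEq_phiEq Δ Δstar n).symm⟩

/-- If every slot is canonical, the most recent canonical slot before `n` is `n - 1`. -/
theorem lastCanonical_eq_pred {γ : ℝ} {φ : ℕ → Prop} {ν : ℕ → ℝ → Prop}
    (h : ∀ k, chi γ φ ν k) (n : ℕ) : lastCanonical γ φ ν n = n - 1 :=
  IsGreatest.csSup_eq ⟨⟨h _, le_rfl⟩, fun _ hk => hk.2⟩

theorem tEq_sub_tEq_pred (Δ Δstar : ℝ) {n : ℕ} (hn : 1 ≤ n) :
    tEq Δ Δstar n - tEq Δ Δstar (n - 1) = Δ := by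
  simp only [tEq, Nat.cast_sub hn, Nat.cast_one]
  ring

theorem proposerPayoff_equilibrium {Δ γ : ℝ} (hΔ : 0 ≤ Δ) (hγ : γ ≤ 1) (α μ Δstar : ℝ)
    {n : ℕ} (hn : 1 ≤ n) :
    proposerPayoff α μ γ (tEq Δ Δstar) (phiEq Δ Δstar)
      (nuEq Δ Δstar (tEq Δ Δstar) (phiEq Δ Δstar)) n = α + μ * Δ := by
  have h := chi_equilibrium hγ Δ Δstar
  rw [proposerPayoff, if_pos (h n), lastCanonical_eq_pred h,
    tEq_sub_tEq_pred Δ Δstar hn, max_eq_left hΔ]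

/-- On the equilibrium path: for every slot `n ≥ 1`, the most recent
canonical slot is `n - 1`, `t_n − t_{n_-} = Δ`, and proposer `n`'s payoff is
exactly `α + μ·Δ`, a strictly positive value independent of the coordination
point `Δ* ∈ [0, Δ]` (economic fairness among participants). -/
theorem equilibrium_payoff_fairness
    (Δ Δstar γ α μ : ℝ)
    (hΔ : 0 < Δ) (hstar : Δstar ∈ Set.Icc (0 : ℝ) Δ)
    (hγ : γ ∈ Set.Ioc (0 : ℝ) 1) (hα : 0 < α) (hμ : 0 < μ) :
    (∀ n : ℕ, 1 ≤ n →
      lastCanonical γ (phiEq Δ Δstar)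
          (nuEq Δ Δstar (tEq Δ Δstar) (phiEq Δ Δstar)) n = n - 1 ∧
      tEq Δ Δstar n - tEq Δ Δstar (n - 1) = Δ ∧
      proposerPayoff α μ γ (tEq Δ Δstar) (phiEq Δ Δstar)
          (nuEq Δ Δstar (tEq Δ Δstar) (phiEq Δ Δstar)) n = α + μ * Δ) ∧
    0 < α + μ * Δ ∧
    -- the equilibrium payoff does not depend on the coordination point Δ*
    (∀ Δstar₁ Δstar₂ : ℝ, Δstar₁ ∈ Set.Icc (0 : ℝ) Δ →
      Δstar₂ ∈ Set.Icc (0 : ℝ) Δ → ∀ n : ℕ, 1 ≤ n →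
      proposerPayoff α μ γ (tEq Δ Δstar₁) (phiEq Δ Δstar₁)
          (nuEq Δ Δstar₁ (tEq Δ Δstar₁) (phiEq Δ Δstar₁)) n =
        proposerPayoff α μ γ (tEq Δ Δstar₂) (phiEq Δ Δstar₂)
          (nuEq Δ Δstar₂ (tEq Δ Δstar₂) (phiEq Δ Δstar₂)) n) := by
  refine ⟨fun n hn => ⟨lastCanonical_eq_pred (chi_equilibrium hγ.2 Δ Δstar) n,
    tEq_sub_tEq_pred Δ Δstar hn, proposerPayoff_equilibrium hΔ.le hγ.2 α μ Δstar hn⟩,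
    by positivity, fun Δstar₁ Δstar₂ _ _ n hn => ?_⟩
  rw [proposerPayoff_equilibrium hΔ.le hγ.2 α μ Δstar₁ hn,
    proposerPayoff_equilibrium hΔ.le hγ.2 α μ Δstar₂ hn]
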